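/- The flipped unimodal order ≤_flip on {0,1}^∞ is a cylinder order whose smallest accumulation point m_flip := m_{≤_flip} equals τ_{1,3}(m_alt). Moreover, 0·m_flip = F(m_uni), where F(a_1a_2⋯) := (1−a_1)(1−a_2)⋯ and 0·x denotes prepending the letter 0 to x, and M_{≤_uni} = {1·F(a) : a ∈ M_{≤_flip}} ∪ {0^∞}. -/

import Mathlib

open scoped Classical

noncomputable section

/-- The ultrametric on infinite words: `d(a,b) = 2^{-min{n ≥ 1 : a_n ≠ b_n}}`
(words are indexed from 0 here, so position `i` corresponds to `n = i+1`). -/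
noncomputable def wdist {A : Type*} [DecidableEq A] (a b : ℕ → A) : ℝ :=
  if h : ∃ n, a n ≠ b n then (2 : ℝ)⁻¹ ^ (Nat.find h + 1) else 0

/-- The tail `a_{k+1} a_{k+2} ⋯` of an infinite word. -/
def shiftn {A : Type*} (a : ℕ → A) (k : ℕ) : ℕ → A := fun n => a (n + k)

/-- The set of tails of an infinite word (including the word itself). -/
def tails {A : Type*} (a : ℕ → A) : Set (ℕ → A) := {b | ∃ k, b = shiftn a k}

/-- A cylinder order: a total order such that `a ≤ b ≤ c` implies `d(a,b) ≤ d(a,c)`. -/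
def IsCylOrder {A : Type*} [DecidableEq A] (le : (ℕ → A) → (ℕ → A) → Prop) : Prop :=
  (∀ a b, le a b ∨ le b a) ∧
  (∀ a b, le a b → le b a → a = b) ∧
  (∀ a b c, le a b → le b c → le a c) ∧
  (∀ a b c, le a b → le b c → wdist a b ≤ wdist a c)

/-- Strict comparison associated to an order relation. -/
def wlt {A : Type*} (le : (ℕ → A) → (ℕ → A) → Prop) (a b : ℕ → A) : Prop :=
  le a b ∧ a ≠ b

/-- `m` is the least upper bound of the set `s` with respect to `le`. -/
def IsSupOf {A : Type*} (le : (ℕ → A) → (ℕ → A) → Prop) (s : Set (ℕ → A))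
    (m : ℕ → A) : Prop :=
  (∀ x ∈ s, le x m) ∧ ∀ b, (∀ x ∈ s, le x b) → le m b

/-- The set `M_≤ = {s_≤(a) : a ∈ A^∞}` of sup-words. -/
def supWords {A : Type*} (le : (ℕ → A) → (ℕ → A) → Prop) : Set (ℕ → A) :=
  {m | ∃ a, IsSupOf le (tails a) m}

/-- `x` is an accumulation point of `M` in the metric `wdist`. -/
def IsAccPt' {A : Type*} [DecidableEq A] (M : Set (ℕ → A)) (x : ℕ → A) : Prop :=
  ∀ ε : ℝ, 0 < ε → ∃ y ∈ M, y ≠ x ∧ wdist x y < ε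

/-- `x` is the smallest (w.r.t. `le`) accumulation point of `M`. -/
def IsSmallestAcc {A : Type*} [DecidableEq A] (le : (ℕ → A) → (ℕ → A) → Prop)
    (M : Set (ℕ → A)) (x : ℕ → A) : Prop :=
  IsAccPt' M x ∧ ∀ y, IsAccPt' M y → le x y

/-- Membership in the cylinder given by the finite word `w`. -/
def inCyl {A : Type*} (w : List A) (a : ℕ → A) : Prop :=
  ∀ i : Fin w.length, a i.val = w.get i

/-- `[u] < [v]` for cylinders: every element of `[u]` is strictly below every element of `[v]`. -/
def cylLt {A : Type*} (le : (ℕ → A) → (ℕ → A) → Prop) (u v : List A) : Prop :=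
  ∀ a b, inCyl u a → inCyl v b → wlt le a b

/-- Infinite binary words. -/
abbrev W2 := ℕ → Bool

/-- The word `0^∞`. -/
def w0 : W2 := fun _ => false

/-- The word `1^∞`. -/
def w1 : W2 := fun _ => true

/-- The word `10^∞`. -/
def w10inf : W2 := fun n => decide (n = 0)

/-- The periodic word `w^∞` for a finite word `w`. -/
def perW (w : List Bool) : W2 := fun n => w.getD (n % w.length) false

/-- A substitution on `{0,1}`, given by the images of the two letters. -/
abbrev Sub2 := Bool → List Bool

/-- Action of a substitution on finite words. -/
def listApply (f : Sub2) (l : List Bool) : List Bool := (l.map f).flatten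

/-- Action of a (nonerasing) substitution on infinite words. -/
def subApply (f : Sub2) (a : W2) : W2 :=
  fun n => (listApply f (List.ofFn (fun i : Fin (n + 1) => a i.val))).getD n false

/-- The substitution `τ_{j,k} : 0 ↦ 10^j, 1 ↦ 10^k`. -/
def tauS (j k : ℕ) : Sub2 := fun b => true :: List.replicate (if b then k else j) false

/-- Membership in the set `S = {τ_{j,k} : 0 ≤ j < k}`. -/
def memS (f : Sub2) : Prop := ∃ j k : ℕ, j < k ∧ f = tauS j k

/-- Apply a finite composition `σ_1 ∘ ⋯ ∘ σ_n` (given as a list) to an infinite word. -/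
def applyList (L : List Sub2) (a : W2) : W2 := L.foldr subApply a

/-- Apply a finite composition `σ_1 ∘ ⋯ ∘ σ_n` (given as a list) to a finite word. -/
def listApplyL (L : List Sub2) (l : List Bool) : List Bool := L.foldr listApply l

/-- `σ_{[1,n]} = σ_1 ∘ ⋯ ∘ σ_n` applied to an infinite word, for `σ ∈ S^∞`
(indexed from 0 in Lean). -/
def compUpTo (σ : ℕ → Sub2) (n : ℕ) (a : W2) : W2 :=
  applyList (List.ofFn (fun i : Fin n => σ i.val)) a

/-- `m` is the limit word `lim_{n → ∞} σ_{[1,n]}(a)`. -/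
def IsLimitWord (σ : ℕ → Sub2) (a m : W2) : Prop :=
  ∀ ε : ℝ, 0 < ε → ∃ N : ℕ, ∀ n ≥ N, wdist (compUpTo σ n a) m < ε

/-- Strict alternating lexicographic order on `{0,1}^∞`: at the first differing position
`i` (0-indexed, so the paper's index `n = i+1`), `a <_alt b` iff `a_i < b_i` and `i+1` is
odd (i.e. `i` even), or `a_i > b_i` and `i+1` is even (i.e. `i` odd). -/
def altLt (a b : W2) : Prop :=
  ∃ i : ℕ, (∀ m < i, a m = b m) ∧
    (if Even i then a i = false ∧ b i = true else a i = true ∧ b i = false)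

/-- The alternating lexicographic order on `{0,1}^∞`. -/
def altLe (a b : W2) : Prop := a = b ∨ altLt a b

/-- Strict unimodal order on `{0,1}^∞`: at the first differing position `i`,
`a <_uni b` iff `a_i < b_i` and the number of 1's among `a_0 ⋯ a_{i-1}` is even,
or `a_i > b_i` and that number is odd. -/
def uniLt (a b : W2) : Prop :=
  ∃ i : ℕ, (∀ m < i, a m = b m) ∧
    (if Even ((List.range i).countP (fun m => a m)) then a i = false ∧ b i = true
      else a i = true ∧ b i = false)

/-- The unimodal order on `{0,1}^∞`. -/
def uniLe (a b : W2) : Prop := a = b ∨ uniLt a b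

/-- Strict flipped unimodal order on `{0,1}^∞`: at the first differing position `i`,
`a <_flip b` iff `a_i < b_i` and the number of 0's among `a_0 ⋯ a_{i-1}` is even,
or `a_i > b_i` and that number is odd. -/
def flipLt (a b : W2) : Prop :=
  ∃ i : ℕ, (∀ m < i, a m = b m) ∧
    (if Even ((List.range i).countP (fun m => !(a m))) then a i = false ∧ b i = true
      else a i = true ∧ b i = false)

/-- The flipped unimodal order on `{0,1}^∞`. -/
def flipLe (a b : W2) : Prop := a = b ∨ flipLt a b

/-- The digit-flipping map `F(a_1 a_2 ⋯) = (1-a_1)(1-a_2)⋯`. -/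
def flipW (a : W2) : W2 := fun n => !(a n)

/-- Prepend a letter to an infinite word. -/
def consW (b : Bool) (a : W2) : W2 := fun n => match n with
  | 0 => b
  | Nat.succ m => a m

/-- Parity of the total weight of the first `i` letters of `a`. -/
def prefixParity (w : Bool → Bool) (a : W2) : ℕ → Bool
  | 0 => false
  | i + 1 => (prefixParity w a i ^^ w (a i))

/-- `a` is below `b`, with first difference at `i`, in the order which is reversed after
prefixes of odd weight. -/
def parityLtAt (w : Bool → Bool) (i : ℕ) (a b : W2) : Prop :=
  (∀ m < i, a m = b m) ∧ a i = prefixParity w a i ∧ b i = !prefixParity w a i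

/-- The order on binary words which is reversed after prefixes of odd weight. -/
def parityLe (w : Bool → Bool) (a b : W2) : Prop := a = b ∨ ∃ i, parityLtAt w i a b

/-- The words that dominate all of their tails. -/
def tailMax (w : Bool → Bool) : Set W2 := {m | ∀ k, parityLe w (shiftn m k) m}

section ParityOrder

variable {w : Bool → Bool}

theorem prefixParity_congr {a b : W2} {i : ℕ} (h : ∀ m < i, a m = b m) :
    prefixParity w a i = prefixParity w b i := by
  induction i with
  | zero => rfl
  | succ i ih =>
    simp only [prefixParity]
    rw [ih fun m hm => h m (by omega), h i (by omega)]

theorem prefixParity_add (a : W2) (k n : ℕ) :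
    prefixParity w a (n + k) = (prefixParity w a k ^^ prefixParity w (shiftn a k) n) := by
  induction n with
  | zero => simp [prefixParity]
  | succ n ih =>
    rw [Nat.add_right_comm]
    simp only [prefixParity, ih, shiftn, Bool.xor_assoc]

theorem parityLtAt_of_ne {a b : W2} {i : ℕ} (h : ∀ m < i, a m = b m) (hi : a i ≠ b i) :
    parityLtAt w i a b ∨ parityLtAt w i b a := by
  have hp := prefixParity_congr (w := w) h
  unfold parityLtAt
  rw [← hp]
  have h' : ∀ m < i, b m = a m := fun m hm => (h m hm).symm
  cases hs : prefixParity w a i <;> cases ha : a i <;> cases hb : b i <;> simp_all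

theorem exists_first_ne {A : Type*} {a b : ℕ → A} (h : a ≠ b) :
    ∃ i, (∀ m < i, a m = b m) ∧ a i ≠ b i := by
  have h' : ∃ n, a n ≠ b n := Function.ne_iff.mp h
  exact ⟨Nat.find h', fun m hm => not_not.mp (Nat.find_min h' hm), Nat.find_spec h'⟩

theorem parityLtAt.ne_apply {a b : W2} {i : ℕ} (h : parityLtAt w i a b) : a i ≠ b i := by
  rw [h.2.1, h.2.2]
  simp

theorem parityLtAt.trans {a b c : W2} {i k : ℕ} (h : parityLtAt w i a b)
    (h' : parityLtAt w k b c) : parityLtAt w (min i k) a c := by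
  have hp := prefixParity_congr (w := w) h.1
  rcases lt_trichotomy i k with hik | rfl | hik
  · rw [min_eq_left hik.le]
    exact ⟨fun m hm => (h.1 m hm).trans (h'.1 m (hm.trans hik)), h.2.1, by
      rw [← h'.1 i hik, h.2.2]⟩
  · have h1 := h.2.2
    rw [h'.2.1, hp] at h1
    simp at h1
  · rw [min_eq_right hik.le]
    have hpk : prefixParity w a k = prefixParity w b k :=
      prefixParity_congr fun m hm => h.1 m (hm.trans hik)
    exact ⟨fun m hm => (h.1 m (hm.trans hik)).trans (h'.1 m hm), by
      rw [h.1 k hik, hpk, h'.2.1], by rw [hpk, h'.2.2]⟩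

theorem parityLtAt.not_parityLe {a b : W2} {i : ℕ} (h : parityLtAt w i a b) :
    ¬ parityLe w b a := by
  rintro (rfl | ⟨k, hk⟩)
  · exact h.ne_apply rfl
  · exact (h.trans hk).ne_apply rfl

theorem parityLe_refl (a : W2) : parityLe w a a := Or.inl rfl

theorem exists_parityLtAt_of_not_parityLe {a b : W2} (h : ¬ parityLe w a b) :
    ∃ i, parityLtAt w i b a := by
  have hne : a ≠ b := fun e => h (Or.inl e)
  obtain ⟨i, h1, h2⟩ := exists_first_ne hne
  rcases parityLtAt_of_ne (w := w) h1 h2 with h3 | h3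
  · exact absurd (Or.inr ⟨i, h3⟩) h
  · exact ⟨i, h3⟩

theorem parityLe_total (a b : W2) : parityLe w a b ∨ parityLe w b a := by
  by_cases h : parityLe w a b
  · exact Or.inl h
  · exact Or.inr (Or.inr (exists_parityLtAt_of_not_parityLe h))

theorem parityLe_antisymm {a b : W2} (h : parityLe w a b) (h' : parityLe w b a) : a = b := by
  rcases h with h | ⟨i, hi⟩
  · exact h
  · exact absurd h' hi.not_parityLe

theorem parityLe_trans {a b c : W2} (h : parityLe w a b) (h' : parityLe w b c) :
    parityLe w a c := by
  rcases h with rfl | ⟨i, hi⟩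
  · exact h'
  rcases h' with rfl | ⟨k, hk⟩
  · exact Or.inr ⟨i, hi⟩
  · exact Or.inr ⟨_, hi.trans hk⟩

theorem parityLtAt.parityLe {a b : W2} {i : ℕ} (h : parityLtAt w i a b) : parityLe w a b :=
  Or.inr ⟨i, h⟩

theorem parityLtAt_zero {a b : W2} (ha : a 0 = false) (hb : b 0 = true) :
    parityLtAt w 0 a b :=
  ⟨by simp, by simp [prefixParity, ha], by simp [prefixParity, hb]⟩

theorem parityLtAt_add_of_odd {a b : W2} {n k : ℕ} (h : ∀ m < k, a m = b m)
    (hk : prefixParity w a k = true) (hs : parityLtAt w n (shiftn b k) (shiftn a k)) :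
    parityLtAt w (n + k) a b := by
  obtain ⟨h1, h2, h3⟩ := hs
  have hp := prefixParity_congr (w := w) h1
  refine ⟨fun m hm => ?_, ?_, ?_⟩
  · by_cases hmk : m < k
    · exact h m hmk
    · have := h1 (m - k) (by omega)
      simpa [shiftn, Nat.sub_add_cancel (not_lt.mp hmk)] using this.symm
  · rw [prefixParity_add, hk, ← hp, Bool.true_xor, ← h3]
    simp [shiftn]
  · rw [prefixParity_add, hk, ← hp, Bool.true_xor, Bool.not_not, ← h2]
    simp [shiftn]

end ParityOrder

theorem wdist_eq_of_first_ne {A : Type*} [DecidableEq A] {a b : ℕ → A} {i : ℕ}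
    (h : ∀ m < i, a m = b m) (hi : a i ≠ b i) : wdist a b = (2 : ℝ)⁻¹ ^ (i + 1) := by
  have hex : ∃ n, a n ≠ b n := ⟨i, hi⟩
  rw [wdist, dif_pos hex]
  congr 2
  exact (Nat.find_eq_iff hex).mpr ⟨hi, fun m hm => not_not.mpr (h m hm)⟩

theorem wdist_self {A : Type*} [DecidableEq A] (a : ℕ → A) : wdist a a = 0 := by
  simp [wdist]

theorem wdist_nonneg {A : Type*} [DecidableEq A] (a b : ℕ → A) : 0 ≤ wdist a b := by
  unfold wdist
  split <;> positivity

theorem wdist_lt_iff {A : Type*} [DecidableEq A] {a b : ℕ → A} {n : ℕ} :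
    wdist a b < (2 : ℝ)⁻¹ ^ n ↔ ∀ m < n, a m = b m := by
  by_cases hab : a = b
  · subst hab
    simp [wdist_self]
  obtain ⟨i, h1, h2⟩ := exists_first_ne hab
  rw [wdist_eq_of_first_ne h1 h2,
    pow_lt_pow_iff_right_of_lt_one₀ (by norm_num) (by norm_num)]
  constructor
  · intro h m hm
    exact h1 m (by omega)
  · intro h
    by_contra hn
    exact h2 (h i (by omega))

theorem isAccPt'_iff {A : Type*} [DecidableEq A] {M : Set (ℕ → A)} {x : ℕ → A} :
    IsAccPt' M x ↔ ∀ n, ∃ y ∈ M, y ≠ x ∧ ∀ m < n, x m = y m := by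
  constructor
  · intro h n
    obtain ⟨y, hy, hne, hd⟩ := h ((2 : ℝ)⁻¹ ^ n) (by positivity)
    exact ⟨y, hy, hne, wdist_lt_iff.mp hd⟩
  · intro h ε hε
    obtain ⟨n, hn⟩ := exists_pow_lt_of_lt_one hε (by norm_num : (2 : ℝ)⁻¹ < 1)
    obtain ⟨y, hy, hne, hd⟩ := h n
    exact ⟨y, hy, hne, (wdist_lt_iff.mpr hd).trans hn⟩

theorem isCylOrder_parityLe (w : Bool → Bool) : IsCylOrder (parityLe w) := by
  refine ⟨parityLe_total, fun _ _ => parityLe_antisymm, fun _ _ _ => parityLe_trans, ?_⟩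
  rintro a b c (rfl | ⟨i, hi⟩) h'
  · rw [wdist_self]
    exact wdist_nonneg _ _
  rcases h' with rfl | ⟨k, hk⟩
  · exact le_rfl
  have hac := hi.trans hk
  rw [wdist_eq_of_first_ne hi.1 hi.ne_apply, wdist_eq_of_first_ne hac.1 hac.ne_apply]
  exact pow_le_pow_of_le_one (by norm_num) (by norm_num) (by omega)

section SupWords

variable {w : Bool → Bool}

/-- Parity of the prefixes of `lowerGreedy w m n`. -/
def lowerGreedyParity (w : Bool → Bool) (m : W2) (n : ℕ) : ℕ → Bool
  | 0 => false
  | i + 1 => (lowerGreedyParity w m n i ^^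
      w (if i < n then m i else if i = n then lowerGreedyParity w m n i
        else !lowerGreedyParity w m n i))

/-- The largest word that agrees with `m` before position `n` and has at position `n` the
smaller of the two possible letters. -/
def lowerGreedy (w : Bool → Bool) (m : W2) (n : ℕ) : W2 := fun i =>
  if i < n then m i else if i = n then lowerGreedyParity w m n i
    else !lowerGreedyParity w m n i

theorem prefixParity_lowerGreedy (m : W2) (n i : ℕ) :
    prefixParity w (lowerGreedy w m n) i = lowerGreedyParity w m n i := by
  induction i with
  | zero => rfl
  | succ i ih => rw [prefixParity, ih, lowerGreedyParity, lowerGreedy]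

theorem exists_tail_agree {a m : W2} (h : IsSupOf (parityLe w) (tails a) m) (n : ℕ) :
    ∃ k, ∀ i < n, shiftn a k i = m i := by
  induction n with
  | zero => exact ⟨0, by simp⟩
  | succ n ih =>
    obtain ⟨k, hk⟩ := ih
    by_contra hcon
    push Not at hcon
    have hpref : ∀ i < n, m i = lowerGreedy w m n i := by
      intro i hi
      simp [lowerGreedy, hi]
    have hpn := prefixParity_congr (w := w) hpref
    have hbn : lowerGreedy w m n n = prefixParity w (lowerGreedy w m n) n := by
      rw [prefixParity_lowerGreedy]
      simp [lowerGreedy]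
    have hlow : ∀ k, (∀ i < n, shiftn a k i = m i) →
        shiftn a k n = prefixParity w m n ∧ m n = !prefixParity w m n := by
      intro k hk
      obtain ⟨i, hi, hne⟩ := hcon k
      have hin : i = n := by
        by_contra hin
        exact hne (hk i (by omega))
      subst hin
      have hp := prefixParity_congr (w := w) hk
      rcases parityLtAt_of_ne (w := w) hk hne with hlt | hlt
      · exact ⟨hlt.2.1.trans hp, by rw [← hp]; exact hlt.2.2⟩
      · exact absurd (h.1 _ ⟨k, rfl⟩) hlt.not_parityLe
    have hlt : parityLtAt w n (lowerGreedy w m n) m :=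
      ⟨fun i hi => (hpref i hi).symm, hbn, by rw [← hpn]; exact (hlow k hk).2⟩
    refine hlt.not_parityLe (h.2 _ ?_)
    rintro _ ⟨l, rfl⟩
    by_cases hl : ∀ i < n, shiftn a l i = m i
    · by_cases heq : shiftn a l = lowerGreedy w m n
      · exact Or.inl heq
      obtain ⟨i, h1, h2⟩ := exists_first_ne heq
      have hni : n < i := by
        by_contra hcn
        rcases (not_lt.mp hcn).lt_or_eq with hin | rfl
        · exact h2 ((hl i hin).trans (hpref i hin))
        · exact h2 (by rw [(hlow l hl).1, hbn, hpn])
      have hbi : lowerGreedy w m n i = !prefixParity w (lowerGreedy w m n) i := by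
        rw [prefixParity_lowerGreedy]
        simp [lowerGreedy, hni.not_gt, hni.ne']
      rcases parityLtAt_of_ne (w := w) h1 h2 with h3 | h3
      · exact h3.parityLe
      · have := h3.2.1
        rw [hbi] at this
        simp at this
    · push Not at hl
      obtain ⟨j, hj, hne⟩ := hl
      rcases h.1 _ ⟨l, rfl⟩ with heq | ⟨i, hi⟩
      · exact absurd (congrFun heq j) hne
      · have hin : i < n := by
          by_contra hin
          exact hne (hi.1 j (by omega))
        refine Or.inr ⟨i, fun q hq => ?_, hi.2.1, ?_⟩
        · rw [hi.1 q hq, hpref q (hq.trans hin)]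
        · rw [← hpref i hin, hi.2.2]

theorem supWords_parityLe (w : Bool → Bool) : supWords (parityLe w) = tailMax w := by
  ext m
  constructor
  · rintro ⟨a, ha⟩ k
    by_contra hcon
    obtain ⟨i, hi⟩ := exists_parityLtAt_of_not_parityLe hcon
    obtain ⟨l, hl⟩ := exists_tail_agree ha (i + k + 1)
    have hlt : parityLtAt w i m (shiftn a (k + l)) := by
      have key : ∀ q ≤ i, shiftn a (k + l) q = shiftn m k q := by
        intro q hq
        have := hl (q + k) (by omega)
        simpa [shiftn, Nat.add_assoc] using this
      exact ⟨fun q hq => by rw [key q hq.le, hi.1 q hq], hi.2.1, by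
        rw [key i le_rfl, hi.2.2]⟩
    exact hlt.not_parityLe (ha.1 _ ⟨_, rfl⟩)
  · intro hm
    refine ⟨m, ?_, fun b hb => hb m ⟨0, rfl⟩⟩
    rintro _ ⟨k, rfl⟩
    exact hm k

theorem eq_w0_of_mem_tailMax {z : W2} (hz : z ∈ tailMax w) (h0 : z 0 = false) : z = w0 := by
  funext k
  by_contra hk
  have hk' : shiftn z k 0 = true := by simpa [shiftn, w0] using hk
  exact (parityLtAt_zero h0 hk').not_parityLe (hz k)

theorem w0_mem_tailMax : w0 ∈ tailMax w := fun _ => Or.inl rfl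

theorem isSmallestAcc_of_finite {M : Set W2} {m : W2} (hacc : IsAccPt' M m)
    (hfin : ∀ i, {z ∈ M | parityLtAt w i z m}.Finite) :
    IsSmallestAcc (parityLe w) M m := by
  refine ⟨hacc, fun y hy => ?_⟩
  by_contra hcon
  obtain ⟨i, hi⟩ := exists_parityLtAt_of_not_parityLe hcon
  have hd : ∀ z : W2, z ≠ y → ∃ n, y n ≠ z n := fun z hz => Function.ne_iff.mp hz.symm
  choose! d hd using hd
  obtain ⟨N, hN⟩ := ((hfin i).image d).bddAbove
  obtain ⟨z, hzM, hne, hz⟩ := isAccPt'_iff.mp hy (max (N + 1) (i + 1))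
  have hlt : parityLtAt w i z m := by
    have hp : prefixParity w y i = prefixParity w z i :=
      prefixParity_congr fun q hq => hz q (by omega)
    exact ⟨fun q hq => by rw [← hz q (by omega), hi.1 q hq], by
      rw [← hz i (by omega), hi.2.1, hp], by rw [hi.2.2, hp]⟩
  have hdz : d z ≤ N := hN ⟨z, ⟨hzM, hlt⟩, rfl⟩
  exact hd z hne (hz (d z) (by omega))

end SupWords

section Substitution

/-- The word `10^k` followed by `a`. -/
def blockCons (k : ℕ) (a : W2) : W2 := fun n =>
  if n = 0 then true else if n ≤ k then false else a (n - (k + 1))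

theorem blockCons_of_le {k n : ℕ} (a : W2) (h0 : n ≠ 0) (h : n ≤ k) :
    blockCons k a n = false := by
  simp [blockCons, h0, h]

theorem blockCons_add (k n : ℕ) (a : W2) : blockCons k a (n + (k + 1)) = a n := by
  have : ¬ n + (k + 1) ≤ k := by omega
  simp [blockCons, this]

theorem shiftn_blockCons (k : ℕ) (a : W2) : shiftn (blockCons k a) (k + 1) = a :=
  funext fun n => blockCons_add k n a

theorem shiftn_shiftn (a : W2) (k l : ℕ) : shiftn (shiftn a k) l = shiftn a (l + k) := by
  funext n
  simp [shiftn, Nat.add_assoc]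

theorem blockCons_agree {k n : ℕ} {a b : W2} (h : ∀ m < n, a m = b m) :
    ∀ m < n + (k + 1), blockCons k a m = blockCons k b m := by
  intro m hm
  unfold blockCons
  split_ifs with h1 h2
  · rfl
  · rfl
  · exact h _ (by omega)

/-- The image of the first `n` letters of `a`. -/
def subPrefix (f : Sub2) (a : W2) (n : ℕ) : List Bool :=
  listApply f (List.ofFn fun i : Fin n => a i.val)

theorem subPrefix_succ (f : Sub2) (a : W2) (n : ℕ) :
    subPrefix f a (n + 1) = subPrefix f a n ++ f (a n) := by
  rw [subPrefix, List.ofFn_succ_last]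
  simp [subPrefix, listApply]

theorem subPrefix_succ' (f : Sub2) (a : W2) (n : ℕ) :
    subPrefix f a (n + 1) = f (a 0) ++ subPrefix f (shiftn a 1) n := by
  simp [subPrefix, listApply, List.ofFn_succ, shiftn]

theorem le_length_subPrefix {f : Sub2} (hf : ∀ b, 0 < (f b).length) (a : W2) (n : ℕ) :
    n ≤ (subPrefix f a n).length := by
  induction n with
  | zero => simp
  | succ n ih =>
    have := hf (a n)
    rw [subPrefix_succ, List.length_append]
    omega

theorem subPrefix_getD {f : Sub2} (hf : ∀ b, 0 < (f b).length) (a : W2) {i n : ℕ}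
    (h : i < n) : (subPrefix f a n).getD i false = subApply f a i := by
  induction n, h using Nat.le_induction with
  | base => rfl
  | succ n hn ih =>
    have hlen := le_length_subPrefix hf a n
    rw [subPrefix_succ, List.getD_append _ _ _ _ (by omega), ih]

theorem subApply_tauS (j k : ℕ) (a : W2) :
    subApply (tauS j k) a =
      blockCons (if a 0 then k else j) (subApply (tauS j k) (shiftn a 1)) := by
  have hf : ∀ b, 0 < (tauS j k b).length := by simp [tauS]
  funext n
  rw [← subPrefix_getD hf a (Nat.lt_succ_self n), subPrefix_succ']
  have hlen : (tauS j k (a 0)).length = (if a 0 then k else j) + 1 := by simp [tauS]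
  by_cases hn : n < (if a 0 then k else j) + 1
  · rw [List.getD_append _ _ _ _ (by omega)]
    rcases n with _ | n
    · rfl
    · rw [blockCons_of_le _ (by omega) (by omega)]
      simp [tauS]
  · rw [List.getD_append_right _ _ _ _ (by omega), hlen, subPrefix_getD hf _ (by omega)]
    obtain ⟨q, rfl⟩ : ∃ q, n = q + ((if a 0 then k else j) + 1) :=
      ⟨n - ((if a 0 then k else j) + 1), by omega⟩
    rw [blockCons_add, Nat.add_sub_cancel]

theorem subApply_tauS_zero (j k : ℕ) (a : W2) : subApply (tauS j k) a 0 = true := by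
  rw [subApply_tauS]
  rfl

theorem subApply_tauS_agree (j k : ℕ) {n : ℕ} {a b : W2} (h : ∀ m < n, a m = b m) :
    ∀ m < n + 1, subApply (tauS j k) a m = subApply (tauS j k) b m := by
  induction n generalizing a b with
  | zero =>
    intro m hm
    obtain rfl : m = 0 := by omega
    rw [subApply_tauS_zero, subApply_tauS_zero]
  | succ n ih =>
    intro m hm
    rw [subApply_tauS j k a, subApply_tauS j k b, ← h 0 (by omega)]
    exact blockCons_agree (ih (a := shiftn a 1) (b := shiftn b 1)
      fun q hq => h (q + 1) (by omega)) m (by omega)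

theorem subApply_tauS_shiftn_mem_tails (j k : ℕ) (a : W2) (n : ℕ) :
    subApply (tauS j k) (shiftn a n) ∈ tails (subApply (tauS j k) a) := by
  induction n generalizing a with
  | zero => exact ⟨0, rfl⟩
  | succ n ih =>
    obtain ⟨l, hl⟩ := ih (shiftn a 1)
    rw [shiftn_shiftn] at hl
    refine ⟨l + ((if a 0 then k else j) + 1), ?_⟩
    rw [hl, ← shiftn_shiftn, subApply_tauS j k a, shiftn_blockCons]

theorem shiftn_subApply_tauS (j k : ℕ) (a : W2) (n : ℕ)
    (h : subApply (tauS j k) a n = true) :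
    ∃ l, shiftn (subApply (tauS j k) a) n = subApply (tauS j k) (shiftn a l) := by
  induction n using Nat.strong_induction_on generalizing a with
  | _ n ih =>
    rcases Nat.eq_zero_or_pos n with rfl | hn
    · exact ⟨0, rfl⟩
    rw [subApply_tauS] at h
    by_cases hle : n ≤ if a 0 then k else j
    · rw [blockCons_of_le _ hn.ne' hle] at h
      cases h
    obtain ⟨q, rfl⟩ : ∃ q, n = q + ((if a 0 then k else j) + 1) :=
      ⟨n - ((if a 0 then k else j) + 1), by omega⟩
    rw [blockCons_add] at h
    obtain ⟨l, hl⟩ := ih q (by omega) (shiftn a 1) h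
    refine ⟨l + 1, ?_⟩
    rw [← shiftn_shiftn, subApply_tauS j k a, shiftn_blockCons, hl, shiftn_shiftn]

theorem exists_subApply_tauS_eq (j k : ℕ) {G : W2 → Prop}
    (h : ∀ t, G t → ∃ b : Bool, ∃ u, G u ∧ t = blockCons (if b then k else j) u)
    {z : W2} (hz : G z) : ∃ y, z = subApply (tauS j k) y := by
  have h' : ∀ t : {t // G t}, ∃ b : Bool, ∃ u : {t // G t},
      t.1 = blockCons (if b then k else j) u.1 := by
    rintro ⟨t, ht⟩
    obtain ⟨b, u, hu, he⟩ := h t ht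
    exact ⟨b, ⟨u, hu⟩, he⟩
  choose b u hbu using h'
  have key : ∀ (n : ℕ) (t : {t // G t}), ∀ m < n,
      t.1 m = subApply (tauS j k) (fun i => b (u^[i] t)) m := by
    intro n
    induction n with
    | zero => simp
    | succ n ih =>
      intro t m hm
      rw [subApply_tauS, hbu t]
      exact blockCons_agree (ih (u t)) m (by omega)
  exact ⟨_, funext fun m => key (m + 1) ⟨z, hz⟩ m (by omega)⟩

variable {w : Bool → Bool} {j : ℕ}

theorem prefixParity_block (hw : w false = true) {a : W2} {n : ℕ} (h0 : a 0 = true)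
    (h : ∀ i, i ≠ 0 → i ≤ n → a i = false) :
    prefixParity w a (n + 1) = (w true ^^ decide (Odd n)) := by
  induction n with
  | zero => simp [prefixParity, h0]
  | succ n ih =>
    rw [prefixParity, ih fun i hi hin => h i hi (by omega), h (n + 1) (by omega) le_rfl, hw]
    by_cases hn : Odd n <;> simp [hn, Nat.odd_add_one]

theorem prefixParity_blockCons (hw : w false = true) {k : ℕ} (a : W2) :
    prefixParity w (blockCons k a) (k + 1) = (w true ^^ decide (Odd k)) :=
  prefixParity_block hw rfl fun _ => blockCons_of_le a

/-- Under these weights both `10^j` and `10^{j+2}` are odd, so that `τ_{j,j+2}` carries the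
alternating order to the order given by `w`. -/
theorem parityLtAt_subApply_tauS (hw : w false = true) (hw' : w true = decide (Even j))
    {a b : W2} {i : ℕ} (h : parityLtAt (fun _ => true) i a b) :
    ∃ l, parityLtAt w l (subApply (tauS j (j + 2)) a) (subApply (tauS j (j + 2)) b) := by
  have hodd : ∀ c : Bool, (w true ^^ decide (Odd (if c then j + 2 else j))) = true := by
    intro c
    rw [hw']
    by_cases hj : Even j <;> cases c <;> simp [hj, Nat.even_add, ← Nat.not_even_iff_odd]
  induction i generalizing a b with
  | zero =>
    obtain ⟨-, ha, hb⟩ := h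
    simp only [prefixParity, Bool.not_false] at ha hb
    refine ⟨j + 1, ?_⟩
    have hp := prefixParity_blockCons hw (k := j) (subApply (tauS j (j + 2)) (shiftn a 1))
    have ho := hodd false
    simp only [Bool.false_eq_true, if_false] at ho
    rw [ho] at hp
    rw [subApply_tauS j (j + 2) a, subApply_tauS j (j + 2) b, ha, hb]
    simp only [Bool.false_eq_true, if_false, if_true]
    refine ⟨fun m hm => ?_, ?_, ?_⟩
    · rcases Nat.eq_zero_or_pos m with rfl | hm0
      · rfl
      · rw [blockCons_of_le _ hm0.ne' (by omega), blockCons_of_le _ hm0.ne' (by omega)]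
    · rw [hp]
      have := blockCons_add j 0 (subApply (tauS j (j + 2)) (shiftn a 1))
      rw [Nat.zero_add] at this
      rw [this, subApply_tauS_zero]
    · rw [hp, blockCons_of_le _ (by omega) (by omega)]
      rfl
  | succ i ih =>
    have h0 : a 0 = b 0 := h.1 0 (by omega)
    have hp : prefixParity (fun _ => true) a (i + 1) =
        !prefixParity (fun _ => true) (shiftn a 1) i := by
      rw [prefixParity_add]
      simp [prefixParity]
    have hs : ∀ m < i, shiftn a 1 m = shiftn b 1 m := fun m hm => h.1 (m + 1) (by omega)
    have hpc := prefixParity_congr (w := fun _ => true) hs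
    obtain ⟨l, hl⟩ := ih (a := shiftn b 1) (b := shiftn a 1)
      ⟨fun m hm => (hs m hm).symm, by
        rw [← hpc]
        have := h.2.2
        rw [hp, Bool.not_not] at this
        exact this, by
        rw [← hpc]
        have := h.2.1
        rw [hp] at this
        exact this⟩
    rw [subApply_tauS j (j + 2) a, subApply_tauS j (j + 2) b, ← h0]
    refine ⟨_, parityLtAt_add_of_odd (k := (if a 0 then j + 2 else j) + 1) (n := l) ?_ ?_ ?_⟩
    · exact fun m hm => blockCons_agree (n := 0) (by simp) m (by omega)
    · rw [prefixParity_blockCons hw, hodd]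
    · rwa [shiftn_blockCons, shiftn_blockCons]

theorem parityLe_of_subApply_tauS (hw : w false = true) (hw' : w true = decide (Even j))
    {a b : W2}
    (h : parityLe w (subApply (tauS j (j + 2)) a) (subApply (tauS j (j + 2)) b)) :
    parityLe (fun _ => true) a b := by
  by_contra hcon
  obtain ⟨i, hi⟩ := exists_parityLtAt_of_not_parityLe hcon
  obtain ⟨l, hl⟩ := parityLtAt_subApply_tauS hw hw' hi
  exact hl.not_parityLe h

theorem parityLe_subApply_tauS (hw : w false = true) (hw' : w true = decide (Even j))
    {a b : W2} (h : parityLe (fun _ => true) a b) :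
    parityLe w (subApply (tauS j (j + 2)) a) (subApply (tauS j (j + 2)) b) := by
  rcases h with rfl | ⟨i, hi⟩
  · exact parityLe_refl _
  · exact Or.inr (parityLtAt_subApply_tauS hw hw' hi)

theorem subApply_tauS_injective (j : ℕ) :
    Function.Injective (subApply (tauS j (j + 2))) := by
  intro a b hab
  have key : ∀ a b : W2, subApply (tauS j (j + 2)) a = subApply (tauS j (j + 2)) b →
      parityLe (fun _ => true) a b := fun a b h =>
    parityLe_of_subApply_tauS (w := fun c => if c then decide (Even j) else true)
      (by simp) (by simp) (Or.inl h)
  exact parityLe_antisymm (key a b hab) (key b a hab.symm)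

theorem subApply_tauS_mem_tailMax_iff (hw : w false = true) (hw' : w true = decide (Even j))
    {a : W2} :
    subApply (tauS j (j + 2)) a ∈ tailMax w ↔ a ∈ tailMax (fun _ => true) := by
  constructor
  · intro h n
    obtain ⟨l, hl⟩ := subApply_tauS_shiftn_mem_tails j (j + 2) a n
    apply parityLe_of_subApply_tauS hw hw'
    rw [hl]
    exact h l
  · intro h n
    cases hn : subApply (tauS j (j + 2)) a n with
    | false =>
      exact (parityLtAt_zero (by simpa [shiftn] using hn)
        (subApply_tauS_zero _ _ _)).parityLe
    | true =>
      obtain ⟨l, hl⟩ := shiftn_subApply_tauS j (j + 2) a n hn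
      rw [hl]
      exact parityLe_subApply_tauS hw hw' (h l)

/-- A word beginning with `1` and bounded by a word in the cylinder `[10^{j+2}1]` lies in
`[10^j1]` or in `[10^{j+2}1]`. -/
theorem exists_blockCons_of_parityLe (hw : w false = true) (hw' : w true = decide (Even j))
    (hj : j ≤ 1) {t v : W2} (ht : t 0 = true) (hv : v 0 = true)
    (h : parityLe w t (blockCons (j + 2) v)) :
    ∃ b : Bool, ∃ u : W2, u 0 = true ∧ t = blockCons (if b then j + 2 else j) u := by
  have split_at : ∀ n, (∀ i, i ≠ 0 → i ≤ n → t i = false) →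
      t = blockCons n (shiftn t (n + 1)) := by
    intro n hn
    funext i
    rcases Nat.eq_zero_or_pos i with rfl | hi
    · exact ht
    by_cases hin : i ≤ n
    · rw [hn i hi.ne' hin, blockCons_of_le _ hi.ne' hin]
    · obtain ⟨q, rfl⟩ : ∃ q, i = q + (n + 1) := ⟨i - (n + 1), by omega⟩
      rw [blockCons_add, shiftn]
  have agree : ∀ n ≤ j + 2, (∀ i, i ≠ 0 → i ≤ n → t i = false) →
      ∀ m < n + 1, blockCons (j + 2) v m = t m := by
    intro n hn hz m hm
    rcases Nat.eq_zero_or_pos m with rfl | hm0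
    · rw [ht]
      rfl
    · rw [hz m hm0.ne' (by omega), blockCons_of_le _ hm0.ne' (by omega)]
  have parity : ∀ n ≤ j + 2, prefixParity w (blockCons (j + 2) v) (n + 1) =
      (decide (Even j) ^^ decide (Odd n)) := by
    intro n hn
    rw [← hw']
    exact prefixParity_block hw rfl fun i hi hin => blockCons_of_le v hi (by omega)
  have parityOf : ∀ n < j + 2, n ≠ j → (decide (Even j) ^^ decide (Odd n)) = false := by
    clear * - hj
    intro n hn hnj
    obtain ⟨rfl, rfl⟩ | ⟨rfl, rfl⟩ | ⟨rfl, rfl⟩ :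
        (j = 0 ∧ n = 1) ∨ (j = 1 ∧ n = 0) ∨ (j = 1 ∧ n = 2) := by omega
    all_goals decide
  have parityLast : (decide (Even j) ^^ decide (Odd (j + 2))) = true := by
    clear * - hj
    obtain rfl | rfl := Nat.le_one_iff_eq_zero_or_eq_one.mp hj
    all_goals decide
  have forced : ∀ n < j + 2, n ≠ j → (∀ i, i ≠ 0 → i ≤ n → t i = false) →
      t (n + 1) = false := by
    intro n hn hnj hz
    by_contra hc
    rw [Bool.not_eq_false] at hc
    refine parityLtAt.not_parityLe (i := n + 1)
      ⟨agree n hn.le hz, ?_, ?_⟩ h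
    all_goals rw [parity n hn.le]
    · rw [blockCons_of_le _ (by omega) (by omega), parityOf n hn hnj]
    · rw [hc, parityOf n hn hnj]
      rfl
  have extend : ∀ n, (∀ i, i ≠ 0 → i ≤ n → t i = false) → t (n + 1) = false →
      ∀ i, i ≠ 0 → i ≤ n + 1 → t i = false := by
    intro n hz hn i hi hin
    rcases hin.lt_or_eq with hlt | rfl
    · exact hz i hi (by omega)
    · exact hn
  have hzj : ∀ i, i ≠ 0 → i ≤ j → t i = false := by
    have hz0 : ∀ i, i ≠ 0 → i ≤ 0 → t i = false := by
      intro i hi hi'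
      omega
    rcases Nat.le_one_iff_eq_zero_or_eq_one.mp hj with rfl | rfl
    · exact hz0
    · exact extend 0 hz0 (forced 0 (by omega) (by omega) hz0)
  cases hb : t (j + 1) with
  | true =>
    exact ⟨false, shiftn t (j + 1), by simpa [shiftn] using hb, by simpa using split_at j hzj⟩
  | false =>
    have hz1 := extend j hzj hb
    have hz2 := extend (j + 1) hz1 (forced (j + 1) (by omega) (by omega) hz1)
    refine ⟨true, shiftn t (j + 3), ?_, by simpa using split_at (j + 2) hz2⟩
    by_contra hc
    have hc' : t (j + 3) = false := by simpa [shiftn] using hc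
    have hvj : blockCons (j + 2) v (j + 3) = true := by
      have := blockCons_add (j + 2) 0 v
      rw [Nat.zero_add] at this
      exact this.trans hv
    refine parityLtAt.not_parityLe (i := j + 2 + 1)
      ⟨agree (j + 2) le_rfl hz2, ?_, ?_⟩ h
    all_goals rw [parity (j + 2) le_rfl]
    · rw [hvj, parityLast]
    · rw [hc', parityLast]
      rfl

theorem exists_desubstitution (hw : w false = true) (hw' : w true = decide (Even j))
    (hj : j ≤ 1) {z m : W2} (hz : z ∈ tailMax w) (hz0 : z ≠ w0) (hm : m 0 = true) {i : ℕ}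
    (h : parityLtAt w i z (subApply (tauS j (j + 2)) m)) :
    ∃ y ∈ tailMax (fun _ => true), z = subApply (tauS j (j + 2)) y ∧
      ∃ l < i, parityLtAt (fun _ => true) l y m := by
  have hz1 : z 0 = true := by
    by_contra hc
    exact hz0 (eq_w0_of_mem_tailMax hz (by simpa using hc))
  have hm' : subApply (tauS j (j + 2)) m =
      blockCons (j + 2) (subApply (tauS j (j + 2)) (shiftn m 1)) := by
    rw [subApply_tauS, hm]
    rfl
  obtain ⟨y, rfl⟩ := exists_subApply_tauS_eq j (j + 2)
    (G := fun t => t 0 = true ∧ t ∈ tails z) (by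
      rintro _ ⟨ht, n, rfl⟩
      obtain ⟨b, u, hu, he⟩ := exists_blockCons_of_parityLe hw hw' hj ht
        (subApply_tauS_zero _ _ _) (hm' ▸ parityLe_trans (hz n) h.parityLe)
      refine ⟨b, u, ⟨hu, (if b then j + 2 else j) + 1 + n, ?_⟩, he⟩
      rw [← shiftn_shiftn, he, shiftn_blockCons]) (z := z) ⟨hz1, 0, rfl⟩
  refine ⟨y, (subApply_tauS_mem_tailMax_iff hw hw').mp hz, rfl, ?_⟩
  rcases parityLe_of_subApply_tauS hw hw' h.parityLe with rfl | ⟨l, hl⟩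
  · exact absurd rfl h.ne_apply
  · refine ⟨l, ?_, hl⟩
    by_contra hcon
    exact h.ne_apply (subApply_tauS_agree j (j + 2) hl.1 i (by omega))

/-- The words `τ_{0,2}^n(0^∞)`. -/
def altIter (n : ℕ) : W2 := (subApply (tauS 0 2))^[n] w0

/-- The fixed point of `τ_{0,2}`. -/
def altLimit : W2 := fun n => altIter (n + 1) n

theorem altIter_succ (n : ℕ) : altIter (n + 1) = subApply (tauS 0 2) (altIter n) :=
  Function.iterate_succ_apply' _ _ _

theorem altIter_agree_succ (n : ℕ) : ∀ m < n, altIter n m = altIter (n + 1) m := by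
  induction n with
  | zero => simp
  | succ n ih =>
    rw [altIter_succ (n + 1), altIter_succ n]
    exact subApply_tauS_agree 0 2 (by rwa [← altIter_succ])

theorem altLimit_agree (n : ℕ) : ∀ m < n, altLimit m = altIter n m := by
  intro m hm
  induction n, hm using Nat.le_induction with
  | base => rfl
  | succ n hn ih => rw [ih, altIter_agree_succ n m hn]

theorem subApply_altLimit : subApply (tauS 0 2) altLimit = altLimit := by
  funext i
  rw [subApply_tauS_agree 0 2 (altLimit_agree (i + 1)) i (by omega), ← altIter_succ]
  exact (altLimit_agree (i + 2) i (by omega)).symm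

theorem altLimit_zero : altLimit 0 = true := by
  rw [← subApply_altLimit, subApply_tauS_zero]

theorem altIter_ne_altLimit (n : ℕ) : altIter n ≠ altLimit := by
  induction n with
  | zero =>
    intro h
    have := congrFun h 0
    rw [altLimit_zero] at this
    cases this
  | succ n ih =>
    rw [altIter_succ, ← subApply_altLimit]
    exact fun h => ih (subApply_tauS_injective 0 h)

theorem altIter_mem_tailMax (n : ℕ) : altIter n ∈ tailMax (fun _ => true) := by
  induction n with
  | zero => exact w0_mem_tailMax
  | succ n ih =>
    rw [altIter_succ]
    exact (subApply_tauS_mem_tailMax_iff (j := 0) rfl (by simp)).mpr ih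

theorem eq_altIter_of_parityLtAt {i : ℕ} {z : W2} (hz : z ∈ tailMax (fun _ => true))
    (h : parityLtAt (fun _ => true) i z altLimit) : ∃ n ≤ i, z = altIter n := by
  induction i using Nat.strong_induction_on generalizing z with
  | _ i ih =>
    by_cases hz0 : z = w0
    · exact ⟨0, by omega, hz0⟩
    rw [← subApply_altLimit] at h
    obtain ⟨y, hy, rfl, l, hl, hlt⟩ :=
      exists_desubstitution (j := 0) rfl (by simp) (by omega) hz hz0 altLimit_zero h
    obtain ⟨n, hn, rfl⟩ := ih l hl hy hlt
    exact ⟨n + 1, by omega, (altIter_succ n).symm⟩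

theorem isSmallestAcc_subApply_altLimit (hw : w false = true)
    (hw' : w true = decide (Even j)) (hj : j ≤ 1) :
    IsSmallestAcc (parityLe w) (tailMax w) (subApply (tauS j (j + 2)) altLimit) := by
  apply isSmallestAcc_of_finite
  · refine isAccPt'_iff.mpr fun n => ⟨subApply (tauS j (j + 2)) (altIter n), ?_, ?_, ?_⟩
    · exact (subApply_tauS_mem_tailMax_iff hw hw').mpr (altIter_mem_tailMax n)
    · exact fun h => altIter_ne_altLimit n (subApply_tauS_injective j h)
    · exact fun m hm => subApply_tauS_agree j (j + 2) (altLimit_agree n) m (by omega)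
  · intro i
    refine (((Set.finite_Iic i).image
      fun n => subApply (tauS j (j + 2)) (altIter n)).insert w0).subset ?_
    rintro z ⟨hz, hlt⟩
    by_cases hz0 : z = w0
    · exact Or.inl hz0
    obtain ⟨y, hy, rfl, l, hl, hlt'⟩ :=
      exists_desubstitution hw hw' hj hz hz0 altLimit_zero hlt
    obtain ⟨n, hn, rfl⟩ := eq_altIter_of_parityLtAt hy hlt'
    exact Or.inr ⟨n, by simp only [Set.mem_Iic]; omega, rfl⟩

end Substitution

section Unimodal

theorem even_countP_range (w : Bool → Bool) (a : W2) (i : ℕ) :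
    Even ((List.range i).countP fun m => w (a m)) ↔ prefixParity w a i = false := by
  induction i with
  | zero => simp [prefixParity]
  | succ i ih =>
    rw [List.range_succ, List.countP_append, prefixParity]
    cases hp : prefixParity w a i <;> cases hw : w (a i) <;>
      simp_all [Nat.even_add_one]

theorem uniLe_eq : uniLe = parityLe id := by
  funext a b
  simp only [uniLe, uniLt, parityLe, parityLtAt, eq_iff_iff]
  refine or_congr Iff.rfl (exists_congr fun i => and_congr Iff.rfl ?_)
  have := even_countP_range id a i
  simp only [id] at this
  simp only [this]
  cases prefixParity id a i <;> simp

theorem flipLe_eq : flipLe = parityLe not := by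
  funext a b
  simp only [flipLe, flipLt, parityLe, parityLtAt, eq_iff_iff]
  refine or_congr Iff.rfl (exists_congr fun i => and_congr Iff.rfl ?_)
  have h := even_countP_range not a i
  simp only [h]
  cases prefixParity not a i <;> simp

theorem altLe_eq : altLe = parityLe fun _ => true := by
  funext a b
  simp only [altLe, altLt, parityLe, parityLtAt, eq_iff_iff]
  refine or_congr Iff.rfl (exists_congr fun i => and_congr Iff.rfl ?_)
  have h := even_countP_range (fun _ => true) a i
  simp only [List.countP_true, List.length_range] at h
  simp only [h]
  cases prefixParity (fun _ => true) a i <;> simp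

theorem flipW_flipW (a : W2) : flipW (flipW a) = a := funext fun n => Bool.not_not (a n)

theorem prefixParity_flipW (a : W2) (i : ℕ) :
    prefixParity not (flipW a) i = prefixParity id a i := by
  induction i with
  | zero => rfl
  | succ i ih => simp [prefixParity, ih, flipW]

theorem parityLtAt_flipW {a b : W2} {i : ℕ} (h : parityLtAt id i a b) :
    parityLtAt not i (flipW b) (flipW a) := by
  have hp := prefixParity_congr (w := id) h.1
  refine ⟨fun m hm => by simp [flipW, h.1 m hm], ?_, ?_⟩
  · rw [prefixParity_flipW, ← hp]
    simp [flipW, h.2.2]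
  · rw [prefixParity_flipW, ← hp]
    simp [flipW, h.2.1]

theorem parityLe_id_iff {a b : W2} :
    parityLe id a b ↔ parityLe not (flipW b) (flipW a) := by
  have key : ∀ {a b : W2}, parityLe id a b → parityLe not (flipW b) (flipW a) := by
    rintro a b (rfl | ⟨i, hi⟩)
    · exact parityLe_refl _
    · exact (parityLtAt_flipW hi).parityLe
  refine ⟨key, fun h => ?_⟩
  rcases parityLe_total (w := id) a b with h' | h'
  · exact h'
  · have he := congrArg flipW (parityLe_antisymm h (key h'))
    rw [flipW_flipW, flipW_flipW] at he
    exact Or.inl he.symm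

theorem shiftn_consW (c : Bool) (a : W2) : shiftn (consW c a) 1 = a := rfl

theorem consW_shiftn (a : W2) : consW (a 0) (shiftn a 1) = a := by
  funext n
  cases n <;> rfl

theorem flipW_consW (c : Bool) (a : W2) : flipW (consW c a) = consW (!c) (flipW a) := by
  funext n
  cases n <;> rfl

theorem consW_agree {c : Bool} {a b : W2} {n : ℕ} (h : ∀ m < n, a m = b m) :
    ∀ m < n + 1, consW c a m = consW c b m := by
  intro m hm
  cases m with
  | zero => rfl
  | succ m => exact h m (by omega)

theorem parityLe_consW_false {a b : W2} (h : parityLe not a b) :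
    parityLe not (consW false b) (consW false a) := by
  rcases h with rfl | ⟨i, hi⟩
  · exact parityLe_refl _
  · exact (parityLtAt_add_of_odd (k := 1) (consW_agree (n := 0) (by simp)) rfl hi).parityLe

theorem parityLe_consW_false_iff {a b : W2} :
    parityLe not (consW false b) (consW false a) ↔ parityLe not a b := by
  refine ⟨fun h => ?_, parityLe_consW_false⟩
  rcases parityLe_total (w := not) a b with h' | h'
  · exact h'
  · have he := parityLe_antisymm h (parityLe_consW_false h')
    exact Or.inl (congrArg (shiftn · 1) he).symm

theorem parityLe_consW_true (a : W2) : parityLe not a (consW true a) := by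
  by_cases h : ∃ i, a i = false
  · have hmin : ∀ m < Nat.find h, a m = true := fun m hm => by
      simpa using Nat.find_min h hm
    have hp : ∀ i ≤ Nat.find h, prefixParity not a i = false := by
      intro i hi
      induction i with
      | zero => rfl
      | succ i ih => rw [prefixParity, ih (by omega), hmin i (by omega)]; rfl
    have hc : ∀ m ≤ Nat.find h, consW true a m = true := by
      intro m hm
      cases m with
      | zero => rfl
      | succ m => exact hmin m (by omega)
    refine parityLtAt.parityLe (i := Nat.find h) ⟨fun m hm => ?_, ?_, ?_⟩
    · rw [hmin m hm, hc m hm.le]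
    · rw [hp _ le_rfl, Nat.find_spec h]
    · rw [hp _ le_rfl, hc _ le_rfl]
      rfl
  · have h' : ∀ i, a i = true := fun i => by simpa using not_exists.mp h i
    refine Or.inl (funext fun n => ?_)
    cases n with
    | zero => exact h' 0
    | succ n => exact (h' (n + 1)).trans (h' n).symm

theorem consW_true_flipW_mem_tailMax_iff {a : W2} :
    consW true (flipW a) ∈ tailMax id ↔ a ∈ tailMax not := by
  have key : ∀ k, parityLe id (shiftn (consW true (flipW a)) (k + 1))
      (consW true (flipW a)) ↔ parityLe not (consW false a) (shiftn a k) := by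
    intro k
    rw [parityLe_id_iff, flipW_consW, flipW_flipW]
    have : flipW (shiftn (consW true (flipW a)) (k + 1)) = shiftn a k :=
      funext fun n => Bool.not_not (a (n + k))
    rw [this]
    rfl
  have hcons : ∀ k, shiftn a k = consW (a k) (shiftn a (k + 1)) := by
    intro k
    have h := consW_shiftn (shiftn a k)
    rw [shiftn_shiftn, Nat.add_comm] at h
    simpa [shiftn] using h.symm
  constructor
  · intro h k
    induction k with
    | zero => exact parityLe_refl _
    | succ k ih =>
      have hk := (key k).mp (h (k + 1))
      rw [hcons k] at hk ih
      cases hak : a k with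
      | false =>
        rw [hak] at hk
        exact parityLe_consW_false_iff.mp hk
      | true =>
        rw [hak] at ih
        exact parityLe_trans (parityLe_consW_true _) ih
  · intro h k
    cases k with
    | zero => exact parityLe_refl _
    | succ k =>
      rw [key, hcons k]
      cases a k with
      | false => exact parityLe_consW_false (h (k + 1))
      | true => exact (parityLtAt_zero rfl rfl).parityLe

theorem tailMax_id_eq :
    tailMax id = ((fun a => consW true (flipW a)) '' tailMax not) ∪ {w0} := by
  ext m
  constructor
  · intro hm
    cases h0 : m 0 with
    | false => exact Or.inr (eq_w0_of_mem_tailMax hm h0)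
    | true =>
      have he : consW true (flipW (flipW (shiftn m 1))) = m := by
        rw [flipW_flipW, ← h0, consW_shiftn]
      exact Or.inl ⟨flipW (shiftn m 1), consW_true_flipW_mem_tailMax_iff.mp (by rwa [he]), he⟩
  · rintro (⟨a, ha, rfl⟩ | rfl)
    · exact consW_true_flipW_mem_tailMax_iff.mpr ha
    · exact w0_mem_tailMax

theorem isSmallestAcc_tailMax_id {m : W2}
    (h : IsSmallestAcc (parityLe not) (tailMax not) m) :
    IsSmallestAcc (parityLe id) (tailMax id) (consW true (flipW m)) := by
  obtain ⟨hacc, hmin⟩ := h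
  rw [isAccPt'_iff] at hacc
  refine ⟨isAccPt'_iff.mpr fun n => ?_, fun y hy => ?_⟩
  · obtain ⟨z, hz, hne, hagree⟩ := hacc n
    refine ⟨consW true (flipW z), consW_true_flipW_mem_tailMax_iff.mpr hz, fun he => hne ?_,
      fun q hq => consW_agree (n := n) (fun r hr => ?_) q (by omega)⟩
    · have he' := congrArg (fun x => flipW (shiftn x 1)) he
      simpa only [shiftn_consW, flipW_flipW] using he'
    · rw [flipW, flipW, hagree r hr]
  · rw [isAccPt'_iff] at hy
    have hy1 : y 0 = true := by
      by_contra hc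
      rw [Bool.not_eq_true] at hc
      have hw : ∀ n, w0 ≠ y ∧ ∀ q < n + 1, y q = w0 q := by
        intro n
        obtain ⟨z, hz, hne, hagree⟩ := hy (n + 1)
        obtain rfl := eq_w0_of_mem_tailMax hz (by rw [← hagree 0 (by omega), hc])
        exact ⟨hne, hagree⟩
      exact (hw 0).1 (funext fun n => ((hw n).2 n (by omega)).symm)
    have hye : y = consW true (flipW (flipW (shiftn y 1))) := by
      rw [flipW_flipW, ← hy1, consW_shiftn]
    have hle : parityLe not m (flipW (shiftn y 1)) := by
      refine hmin _ (isAccPt'_iff.mpr fun n => ?_)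
      obtain ⟨z, hz, hne, hagree⟩ := hy (n + 1)
      have hz1 : z 0 = true := by rw [← hagree 0 (by omega), hy1]
      have hze : z = consW true (flipW (flipW (shiftn z 1))) := by
        rw [flipW_flipW, ← hz1, consW_shiftn]
      refine ⟨flipW (shiftn z 1), consW_true_flipW_mem_tailMax_iff.mp (hze ▸ hz),
        fun he => hne ?_, fun q hq => ?_⟩
      · rw [hze, he, ← hye]
      · simp only [flipW, shiftn]
        rw [hagree (q + 1) (by omega)]
    rw [hye, parityLe_id_iff, flipW_consW, flipW_consW, flipW_flipW, flipW_flipW]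
    exact parityLe_consW_false hle

end Unimodal

/-- The flipped unimodal order is a cylinder order with
`m_flip = τ_{1,3}(m_alt)`; moreover `0·m_flip = F(m_uni)` and
`M_uni = {1·F(a) : a ∈ M_flip} ∪ {0^∞}`. -/
theorem stmt_13 :
    IsCylOrder flipLe ∧
      (∃ mFlip mAlt mUni : W2,
        IsSmallestAcc flipLe (supWords flipLe) mFlip ∧
        IsSmallestAcc altLe (supWords altLe) mAlt ∧
        IsSmallestAcc uniLe (supWords uniLe) mUni ∧
        mFlip = subApply (tauS 1 3) mAlt ∧
        consW false mFlip = flipW mUni) ∧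
      supWords uniLe = ((fun a => consW true (flipW a)) '' supWords flipLe) ∪ {w0} := by
  rw [flipLe_eq, altLe_eq, uniLe_eq]
  simp only [supWords_parityLe]
  have hflip := isSmallestAcc_subApply_altLimit (w := not) (j := 1) rfl (by simp) le_rfl
  have halt := isSmallestAcc_subApply_altLimit (w := fun _ => true) (j := 0) rfl (by simp)
    (by omega)
  rw [Nat.zero_add, subApply_altLimit] at halt
  refine ⟨isCylOrder_parityLe not, ⟨_, _, _, hflip, halt, isSmallestAcc_tailMax_id hflip, rfl,
    ?_⟩, tailMax_id_eq⟩
  rw [flipW_consW, flipW_flipW]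
  rfl
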